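/- Let q(t,x) = s/t = √(t² − |x|²)/t on {(t,x) : |x| < t}, and for words I (letters in {0,1,2,3}) and J (letters in {1,2,3}) set Ξ^{I,J}(t,x) = (t/s) ∂^I L^J q (t,x). Then Ξ^{I,J} is smooth on {|x| < t}, homogeneous of degree −|I| (i.e. Ξ^{I,J}(λt, λx) = λ^{−|I|} Ξ^{I,J}(t,x) for λ > 0 and |x| < t), and for all further words I₁, J₁ there exists a constant C, depending on I, J, I₁, J₁, such that |∂^{I₁} L^{J₁} Ξ^{I,J}(t,x)| ≤ C for all (t,x) with |x| ≤ t − 1. -/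

import Mathlib

noncomputable section

/-- Spatial part: Euclidean 3-space. -/
abbrev E3 : Type := EuclideanSpace ℝ (Fin 3)

/-- Spacetime points `(t, x) ∈ ℝ × ℝ³`. -/
abbrev Spt : Type := ℝ × E3

/-- Time derivative `∂_t`. -/
def dt (u : Spt → ℝ) : Spt → ℝ := fun p => fderiv ℝ u p (1, 0)

/-- Spatial derivative `∂_a`, `a = 1,2,3`. -/
def dx (a : Fin 3) (u : Spt → ℝ) : Spt → ℝ :=
  fun p => fderiv ℝ u p (0, EuclideanSpace.single a 1)

/-- `∂_α` for `α ∈ {0,1,2,3}`, with `∂_0 = ∂_t`. -/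
def pd : Fin 4 → (Spt → ℝ) → Spt → ℝ := ![dt, dx 0, dx 1, dx 2]

/-- Iterated derivatives `∂^I` for a word `I` in `{0,1,2,3}`. -/
def pdW : List (Fin 4) → (Spt → ℝ) → Spt → ℝ
  | [], u => u
  | α :: I, u => pd α (pdW I u)

/-- Lorentz boost `L_a = x^a ∂_t + t ∂_a`. -/
def lb (a : Fin 3) (u : Spt → ℝ) : Spt → ℝ :=
  fun p => p.2 a * dt u p + p.1 * dx a u p

/-- Iterated Lorentz boosts `L^J` for a word `J` in `{1,2,3}`. -/
def lbW : List (Fin 3) → (Spt → ℝ) → Spt → ℝ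
  | [], u => u
  | a :: J, u => lb a (lbW J u)

/-- Semi-hyperboloidal derivative `∂̄_a = (x^a/t) ∂_t + ∂_a`. -/
def shd (a : Fin 3) (u : Spt → ℝ) : Spt → ℝ :=
  fun p => (p.2 a / p.1) * dt u p + dx a u p

/-- The `Finset` of all words over the alphabet `k` of length at most `n`. -/
def wordsLe (k : Type) [DecidableEq k] [Fintype k] : ℕ → Finset (List k)
  | 0 => {[]}
  | n + 1 => wordsLe k n ∪ (Finset.univ ×ˢ wordsLe k n).image fun q => q.1 :: q.2

/-- The future light cone `K = {(t,x) : |x| < t − 1}`. -/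
def lightCone : Set Spt := {p : Spt | ‖p.2‖ < p.1 - 1}

/-- The weight function `q(t,x) = s/t = √(t² − |x|²)/t`. -/
def qst : Spt → ℝ := fun p => Real.sqrt (p.1 ^ 2 - ‖p.2‖ ^ 2) / p.1

/-- `Ξ^{I,J} = (t/s) ∂^I L^J (s/t)`. -/
def Xi (I : List (Fin 4)) (J : List (Fin 3)) : Spt → ℝ :=
  fun p => p.1 / Real.sqrt (p.1 ^ 2 - ‖p.2‖ ^ 2) * pdW I (lbW J qst) p

open Set

/-- The open future cone `{|x| < t}`. -/
def openCone : Set Spt := {p : Spt | ‖p.2‖ < p.1}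

/-- The derivative of `u` along the vector field `V`. -/
def dirDeriv (V : Spt → Spt) (u : Spt → ℝ) : Spt → ℝ := fun p => fderiv ℝ u p (V p)

/-- The functions which on the open cone are polynomials in `x^b / t`, `1 / t` and `t / s²`,
graded by total degree in `1 / t` and `t / s²`. -/
inductive ConePoly : ℕ → (Spt → ℝ) → Prop
  | zero (n : ℕ) : ConePoly n fun _ => 0
  | const (c : ℝ) : ConePoly 0 fun _ => c
  | slope (b : Fin 3) : ConePoly 0 fun p => p.2 b / p.1
  | invTime : ConePoly 1 fun p => p.1⁻¹
  | weight : ConePoly 1 fun p => p.1 / (p.1 ^ 2 - ‖p.2‖ ^ 2)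
  | add {n : ℕ} {f g : Spt → ℝ} : ConePoly n f → ConePoly n g → ConePoly n fun p => f p + g p
  | mul {m n : ℕ} {f g : Spt → ℝ} :
      ConePoly m f → ConePoly n g → ConePoly (m + n) fun p => f p * g p
  | congr {n : ℕ} {f g : Spt → ℝ} : ConePoly n f → EqOn g f openCone → ConePoly n g

theorem isOpen_openCone : IsOpen openCone :=
  isOpen_lt (by fun_prop) (by fun_prop)

theorem time_pos_of_mem {p : Spt} (hp : p ∈ openCone) : 0 < p.1 :=
  (norm_nonneg _).trans_lt hp

theorem sq_interval_pos_of_mem {p : Spt} (hp : p ∈ openCone) : 0 < p.1 ^ 2 - ‖p.2‖ ^ 2 := by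
  have h : ‖p.2‖ < p.1 := hp
  nlinarith [norm_nonneg p.2]

theorem smul_mem_openCone {l : ℝ} (hl : 0 < l) {p : Spt} (hp : p ∈ openCone) :
    ((l * p.1, l • p.2) : Spt) ∈ openCone := by
  change ‖l • p.2‖ < l * p.1
  rw [norm_smul, Real.norm_of_nonneg hl.le]
  exact mul_lt_mul_of_pos_left hp hl

namespace ConePoly

theorem cast {m n : ℕ} {f : Spt → ℝ} (hf : ConePoly m f) (h : m = n) : ConePoly n f := h ▸ hf

theorem neg {n : ℕ} {f : Spt → ℝ} (hf : ConePoly n f) : ConePoly n fun p => -f p :=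
  (((const (-1)).mul hf).cast (zero_add n)).congr fun p _ => by simp

theorem contDiffOn {n : ℕ} {f : Spt → ℝ} (hf : ConePoly n f) :
    ContDiffOn ℝ (⊤ : ℕ∞) f openCone := by
  induction hf with
  | zero n => exact contDiffOn_const
  | const c => exact contDiffOn_const
  | slope b =>
    exact ContDiffOn.div (by fun_prop) (by fun_prop) fun p hp => (time_pos_of_mem hp).ne'
  | invTime => exact ContDiffOn.inv (by fun_prop) fun p hp => (time_pos_of_mem hp).ne'
  | weight =>
    refine ContDiffOn.div (by fun_prop) ?_ fun p hp => (sq_interval_pos_of_mem hp).ne'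
    exact ((contDiff_fst.pow 2).sub (contDiff_snd.norm_sq ℝ)).contDiffOn
  | add _ _ hf hg => exact hf.add hg
  | mul _ _ hf hg => exact hf.mul hg
  | congr _ h hf => exact hf.congr h

theorem differentiableAt {n : ℕ} {f : Spt → ℝ} (hf : ConePoly n f) {p : Spt}
    (hp : p ∈ openCone) : DifferentiableAt ℝ f p :=
  (hf.contDiffOn.contDiffAt (isOpen_openCone.mem_nhds hp)).differentiableAt (by simp)

theorem homogeneous {n : ℕ} {f : Spt → ℝ} (hf : ConePoly n f) {l : ℝ} (hl : 0 < l) {p : Spt}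
    (hp : p ∈ openCone) : f (l * p.1, l • p.2) = l⁻¹ ^ n * f p := by
  induction hf with
  | zero n => simp
  | const c => simp
  | slope b =>
    have := time_pos_of_mem hp
    simp only [PiLp.smul_apply, smul_eq_mul, pow_zero, one_mul]
    field_simp
  | invTime => simp [mul_comm]
  | weight =>
    have := (sq_interval_pos_of_mem hp).ne'
    have h : (l * p.1) ^ 2 - ‖l • p.2‖ ^ 2 = l ^ 2 * (p.1 ^ 2 - ‖p.2‖ ^ 2) := by
      rw [norm_smul, Real.norm_of_nonneg hl.le]; ring
    simp only [h, pow_one]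
    field_simp
  | add _ _ hf hg => simp only [hf, hg]; ring
  | mul _ _ hf hg => simp only [hf, hg]; ring
  | congr _ h hf => rw [h hp, h (smul_mem_openCone hl hp), hf]

theorem bounded {n : ℕ} {f : Spt → ℝ} (hf : ConePoly n f) :
    ∃ C : ℝ, ∀ p : Spt, ‖p.2‖ ≤ p.1 - 1 → |f p| ≤ C := by
  induction hf with
  | zero n => exact ⟨0, fun p _ => by simp⟩
  | const c => exact ⟨|c|, fun p _ => le_rfl⟩
  | slope b =>
    refine ⟨1, fun p hp => ?_⟩
    have h0 := norm_nonneg p.2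
    have hb : |p.2 b| ≤ ‖p.2‖ := PiLp.norm_apply_le p.2 b
    rw [abs_div, abs_of_pos (by linarith : 0 < p.1)]
    exact div_le_one_of_le₀ (by linarith) (by linarith)
  | invTime =>
    refine ⟨1, fun p hp => ?_⟩
    have h0 := norm_nonneg p.2
    rw [abs_inv, abs_of_pos (by linarith : 0 < p.1)]
    exact inv_le_one_of_one_le₀ (by linarith)
  | weight =>
    refine ⟨1, fun p hp => ?_⟩
    have h0 := norm_nonneg p.2
    have h : p.1 ≤ p.1 ^ 2 - ‖p.2‖ ^ 2 := by nlinarith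
    rw [abs_of_nonneg (div_nonneg (by linarith) (by linarith))]
    exact div_le_one_of_le₀ h (by linarith)
  | add _ _ hf hg =>
    obtain ⟨C, hC⟩ := hf
    obtain ⟨D, hD⟩ := hg
    exact ⟨C + D, fun p hp => (abs_add_le _ _).trans (add_le_add (hC p hp) (hD p hp))⟩
  | mul _ _ hf hg =>
    obtain ⟨C, hC⟩ := hf
    obtain ⟨D, hD⟩ := hg
    refine ⟨C * D, fun p hp => ?_⟩
    rw [abs_mul]
    exact mul_le_mul (hC p hp) (hD p hp) (abs_nonneg _) ((abs_nonneg _).trans (hC p hp))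
  | congr _ h hf =>
    obtain ⟨C, hC⟩ := hf
    refine ⟨C, fun p hp => ?_⟩
    rw [h (show ‖p.2‖ < p.1 by linarith)]
    exact hC p hp

end ConePoly

theorem dirDeriv_congr (V : Spt → Spt) {f g : Spt → ℝ} (h : EqOn g f openCone) :
    EqOn (dirDeriv V g) (dirDeriv V f) openCone := fun p hp => by
  simp only [dirDeriv, (h.eventuallyEq_of_mem (isOpen_openCone.mem_nhds hp)).fderiv_eq]

theorem dirDeriv_mul (V : Spt → Spt) {f g : Spt → ℝ} {p : Spt} (hf : DifferentiableAt ℝ f p)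
    (hg : DifferentiableAt ℝ g p) :
    dirDeriv V (fun p => f p * g p) p = f p * dirDeriv V g p + dirDeriv V f p * g p := by
  simp only [dirDeriv, fderiv_fun_mul hf hg]
  simp [mul_comm]

theorem dirDeriv_div (V : Spt → Spt) {f g : Spt → ℝ} {p : Spt} (hf : DifferentiableAt ℝ f p)
    (hg : DifferentiableAt ℝ g p) (h : g p ≠ 0) :
    dirDeriv V (fun p => f p / g p) p
      = (dirDeriv V f p * g p - f p * dirDeriv V g p) / g p ^ 2 := by
  have hd : HasFDerivAt (fun p => f p / g p) _ p :=
    hf.hasFDerivAt.fun_mul ((hasDerivAt_inv h).comp_hasFDerivAt p hg.hasFDerivAt)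
  simp only [dirDeriv, hd.fderiv]
  simp
  field_simp
  ring

theorem dirDeriv_time (V : Spt → Spt) (p : Spt) : dirDeriv V (fun p => p.1) p = (V p).1 := by
  have h : HasFDerivAt (fun p : Spt => p.1) (ContinuousLinearMap.fst ℝ ℝ E3) p := hasFDerivAt_fst
  simp [dirDeriv, h.fderiv]

theorem dirDeriv_space (V : Spt → Spt) (b : Fin 3) (p : Spt) :
    dirDeriv V (fun p => p.2 b) p = (V p).2 b := by
  have h : HasFDerivAt (fun p : Spt => p.2 b)
      ((EuclideanSpace.proj b : E3 →L[ℝ] ℝ).comp (ContinuousLinearMap.snd ℝ ℝ E3)) p :=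
    ((EuclideanSpace.proj b : E3 →L[ℝ] ℝ).comp (ContinuousLinearMap.snd ℝ ℝ E3)).hasFDerivAt
  simp [dirDeriv, h.fderiv]

theorem hasFDerivAt_sq_interval (p : Spt) :
    HasFDerivAt (fun p : Spt => p.1 ^ 2 - ‖p.2‖ ^ 2)
      ((2 * p.1) • ContinuousLinearMap.fst ℝ ℝ E3
        - 2 • (innerSL ℝ p.2).comp (ContinuousLinearMap.snd ℝ ℝ E3)) p := by
  have h1 : HasFDerivAt (fun p : Spt => p.1) (ContinuousLinearMap.fst ℝ ℝ E3) p := hasFDerivAt_fst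
  have h2 : HasFDerivAt (fun p : Spt => p.2) (ContinuousLinearMap.snd ℝ ℝ E3) p := hasFDerivAt_snd
  simpa using (HasFDerivAt.pow h1 2).fun_sub h2.norm_sq

theorem dirDeriv_sq_interval (V : Spt → Spt) (p : Spt) :
    dirDeriv V (fun p => p.1 ^ 2 - ‖p.2‖ ^ 2) p
      = 2 * p.1 * (V p).1 - 2 * inner ℝ p.2 (V p).2 := by
  simp [dirDeriv, (hasFDerivAt_sq_interval p).fderiv]

theorem dirDeriv_interval (V : Spt → Spt) {p : Spt} (hp : p ∈ openCone) :
    dirDeriv V (fun p => √(p.1 ^ 2 - ‖p.2‖ ^ 2)) p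
      = (p.1 * (V p).1 - inner ℝ p.2 (V p).2) / √(p.1 ^ 2 - ‖p.2‖ ^ 2) := by
  have hs := sq_interval_pos_of_mem hp
  have hr := (Real.sqrt_pos.2 hs).ne'
  simp only [dirDeriv, ((hasFDerivAt_sq_interval p).sqrt hs.ne').fderiv]
  simp
  field_simp

theorem dirDeriv_slope (V : Spt → Spt) (b : Fin 3) {p : Spt} (hp : p ∈ openCone) :
    dirDeriv V (fun p => p.2 b / p.1) p
      = (V p).2 b * p.1⁻¹ - p.2 b / p.1 * (p.1⁻¹ * (V p).1) := by
  have ht := (time_pos_of_mem hp).ne'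
  rw [dirDeriv_div V (by fun_prop) (by fun_prop) ht, dirDeriv_time, dirDeriv_space]
  field_simp

theorem dirDeriv_invTime (V : Spt → Spt) {p : Spt} (hp : p ∈ openCone) :
    dirDeriv V (fun p => p.1⁻¹) p = -(p.1⁻¹ * (p.1⁻¹ * (V p).1)) := by
  have ht := (time_pos_of_mem hp).ne'
  have h := dirDeriv_div V (f := fun _ => 1) (g := fun p => p.1) (p := p) (by fun_prop)
    (by fun_prop) ht
  simp only [one_div, dirDeriv_time] at h
  rw [h]
  simp [dirDeriv]
  field_simp

theorem dirDeriv_weight (V : Spt → Spt) {p : Spt} (hp : p ∈ openCone) :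
    dirDeriv V (fun p => p.1 / (p.1 ^ 2 - ‖p.2‖ ^ 2)) p
      = p.1 / (p.1 ^ 2 - ‖p.2‖ ^ 2) * (p.1⁻¹ * (V p).1
        - 2 * (p.1 / (p.1 ^ 2 - ‖p.2‖ ^ 2) * ((V p).1 - p.1⁻¹ * inner ℝ p.2 (V p).2))) := by
  have ht := (time_pos_of_mem hp).ne'
  have hs := (sq_interval_pos_of_mem hp).ne'
  rw [dirDeriv_div V (by fun_prop) (hasFDerivAt_sq_interval p).differentiableAt hs, dirDeriv_time,
    dirDeriv_sq_interval]
  field_simp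

theorem differentiableAt_interval {p : Spt} (hp : p ∈ openCone) :
    DifferentiableAt ℝ (fun p : Spt => √(p.1 ^ 2 - ‖p.2‖ ^ 2)) p :=
  ((hasFDerivAt_sq_interval p).sqrt (sq_interval_pos_of_mem hp).ne').differentiableAt

theorem differentiableAt_qst {p : Spt} (hp : p ∈ openCone) : DifferentiableAt ℝ qst p := by
  have ht : DifferentiableAt ℝ (fun p : Spt => p.1⁻¹) p := ConePoly.invTime.differentiableAt hp
  exact (differentiableAt_interval hp).fun_mul ht

theorem dirDeriv_qst (V : Spt → Spt) {p : Spt} (hp : p ∈ openCone) :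
    dirDeriv V qst p = qst p * (p.1 / (p.1 ^ 2 - ‖p.2‖ ^ 2)
      * ((V p).1 - p.1⁻¹ * inner ℝ p.2 (V p).2) - p.1⁻¹ * (V p).1) := by
  have ht := (time_pos_of_mem hp).ne'
  have hs := sq_interval_pos_of_mem hp
  have hr := (Real.sqrt_pos.2 hs).ne'
  have h := dirDeriv_div V (differentiableAt_interval hp) (g := fun p => p.1) (by fun_prop) ht
  rw [dirDeriv_interval V hp, dirDeriv_time] at h
  change dirDeriv V qst p = _ at h
  rw [h]
  simp only [qst]
  obtain ⟨r, hr_def⟩ : ∃ r, r = √(p.1 ^ 2 - ‖p.2‖ ^ 2) := ⟨_, rfl⟩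
  have hsq : p.1 ^ 2 - ‖p.2‖ ^ 2 = r ^ 2 := by rw [hr_def, Real.sq_sqrt hs.le]
  rw [← hr_def] at hr ⊢
  rw [hsq]
  field_simp

/-- `V` raises the grading by `k`: it does so on the generators of `ConePoly`, and its logarithmic
derivative of `s / t` lies in degree `k`. -/
structure IsConeField (k : ℕ) (V : Spt → Spt) : Prop where
  time : ConePoly k fun p => p.1⁻¹ * (V p).1
  space (b : Fin 3) : ConePoly k fun p => (V p).2 b * p.1⁻¹
  radial : ConePoly k fun p => p.1 / (p.1 ^ 2 - ‖p.2‖ ^ 2)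
    * ((V p).1 - p.1⁻¹ * inner ℝ p.2 (V p).2)

namespace ConePoly

theorem dirDeriv {k : ℕ} {V : Spt → Spt} (hV : IsConeField k V) {n : ℕ} {f : Spt → ℝ}
    (hf : ConePoly n f) : ConePoly (n + k) (dirDeriv V f) := by
  induction hf with
  | zero n => exact (zero _).congr fun p _ => by simp [_root_.dirDeriv]
  | const c => exact (zero _).congr fun p _ => by simp [_root_.dirDeriv]
  | slope b =>
    refine ((hV.space b).add (((slope b).mul hV.time).cast (zero_add k)).neg |>.congr
      fun p hp => ?_).cast (zero_add k).symm
    rw [dirDeriv_slope V b hp]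
    ring
  | invTime =>
    refine (invTime.mul hV.time).neg.congr fun p hp => ?_
    rw [dirDeriv_invTime V hp]
  | weight =>
    refine (weight.mul (hV.time.add ((const (-2)).mul hV.radial |>.cast (zero_add k)))).congr
      fun p hp => ?_
    rw [dirDeriv_weight V hp]
    ring
  | add hf hg ihf ihg =>
    refine (ihf.add ihg).congr fun p hp => ?_
    simp only [_root_.dirDeriv, fderiv_fun_add (hf.differentiableAt hp) (hg.differentiableAt hp)]
    simp
  | mul hf hg ihf ihg =>
    refine ((hf.mul ihg).cast (by omega)).add ((ihf.mul hg).cast (by omega)) |>.congr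
      fun p hp => ?_
    rw [dirDeriv_mul V (hf.differentiableAt hp) (hg.differentiableAt hp)]
  | congr _ h ih => exact ih.congr (dirDeriv_congr V h)

end ConePoly

theorem IsConeField.exists_dirDeriv_eq_qst_mul {k : ℕ} {V : Spt → Spt} (hV : IsConeField k V)
    {n : ℕ} {u f : Spt → ℝ} (hf : ConePoly n f) (hu : EqOn u (fun p => qst p * f p) openCone) :
    ∃ g, ConePoly (n + k) g ∧ EqOn (dirDeriv V u) (fun p => qst p * g p) openCone := by
  refine ⟨_, (hf.dirDeriv hV).add (hf.mul (hV.radial.add hV.time.neg)), fun p hp => ?_⟩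
  rw [dirDeriv_congr V hu hp, dirDeriv_mul V (differentiableAt_qst hp) (hf.differentiableAt hp),
    dirDeriv_qst V hp]
  ring

/-- The coordinate direction `∂_α`. -/
def coordDir : Fin 4 → Spt :=
  ![(1, 0), (0, EuclideanSpace.single 0 1), (0, EuclideanSpace.single 1 1),
    (0, EuclideanSpace.single 2 1)]

/-- The vector field of the Lorentz boost `L_a`. -/
def boostField (a : Fin 3) : Spt → Spt := fun p => (p.2 a, p.1 • EuclideanSpace.single a 1)

theorem pd_eq_dirDeriv (α : Fin 4) (u : Spt → ℝ) : pd α u = dirDeriv (fun _ => coordDir α) u := by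
  fin_cases α <;> rfl

theorem lb_eq_dirDeriv (a : Fin 3) (u : Spt → ℝ) : lb a u = dirDeriv (boostField a) u := by
  ext p
  have h : boostField a p
      = p.2 a • ((1, 0) : Spt) + p.1 • ((0, EuclideanSpace.single a 1) : Spt) := by
    simp [boostField]
  simp only [dirDeriv, h, map_add, map_smul, lb, dt, dx, smul_eq_mul]

theorem isConeField_time : IsConeField 1 fun _ => ((1, 0) : Spt) where
  time := by simpa using ConePoly.invTime
  space b := by simpa using ConePoly.zero 1
  radial := by simpa using ConePoly.weight

theorem isConeField_space (a : Fin 3) :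
    IsConeField 1 fun _ => ((0, EuclideanSpace.single a 1) : Spt) where
  time := by simpa using ConePoly.zero 1
  space b := (((ConePoly.const (if b = a then 1 else 0)).mul ConePoly.invTime).cast
    (zero_add 1)).congr fun p _ => by simp
  radial := ((ConePoly.weight.mul (ConePoly.slope a)).cast (add_zero 1)).neg.congr fun p _ => by
    simp only [EuclideanSpace.inner_single_right, conj_trivial]
    ring

theorem isConeField_coordDir (α : Fin 4) : IsConeField 1 fun _ => coordDir α := by
  fin_cases α
  exacts [isConeField_time, isConeField_space 0, isConeField_space 1, isConeField_space 2]

theorem isConeField_boostField (a : Fin 3) : IsConeField 0 (boostField a) where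
  time := (ConePoly.slope a).congr fun p _ => by simp [boostField]; ring
  space b := (ConePoly.const (if b = a then 1 else 0)).congr fun p hp => by
    have := (time_pos_of_mem hp).ne'
    simp [boostField]
    split_ifs <;> simp [this]
  radial := (ConePoly.zero 0).congr fun p hp => by
    have := (time_pos_of_mem hp).ne'
    simp [boostField, EuclideanSpace.inner_single_right, inner_smul_right, this]

theorem ConePoly.pdW_lbW (I : List (Fin 4)) (J : List (Fin 3)) {n : ℕ} {f : Spt → ℝ}
    (hf : ConePoly n f) : ConePoly (n + I.length) (pdW I (lbW J f)) := by
  induction I with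
  | nil =>
    induction J with
    | nil => exact hf
    | cons a J ih =>
      simpa only [pdW, lbW, lb_eq_dirDeriv, add_zero] using ih.dirDeriv (isConeField_boostField a)
  | cons α I ih =>
    simpa only [pdW, pd_eq_dirDeriv, List.length_cons, ← add_assoc] using
      ih.dirDeriv (isConeField_coordDir α)

theorem exists_pdW_lbW_qst_eq (I : List (Fin 4)) (J : List (Fin 3)) :
    ∃ f, ConePoly I.length f ∧ EqOn (pdW I (lbW J qst)) (fun p => qst p * f p) openCone := by
  induction I with
  | nil =>
    induction J with
    | nil => exact ⟨_, .const 1, fun p _ => (mul_one _).symm⟩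
    | cons a J ih =>
      obtain ⟨f, hf, hu⟩ := ih
      simpa only [pdW, lbW, lb_eq_dirDeriv, add_zero] using
        (isConeField_boostField a).exists_dirDeriv_eq_qst_mul hf hu
  | cons α I ih =>
    obtain ⟨f, hf, hu⟩ := ih
    simpa only [pdW, pd_eq_dirDeriv, List.length_cons, ← add_assoc] using
      (isConeField_coordDir α).exists_dirDeriv_eq_qst_mul hf hu

theorem conePoly_Xi (I : List (Fin 4)) (J : List (Fin 3)) : ConePoly I.length (Xi I J) := by
  obtain ⟨f, hf, hu⟩ := exists_pdW_lbW_qst_eq I J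
  refine hf.congr fun p hp => ?_
  have ht := (time_pos_of_mem hp).ne'
  have hr := (Real.sqrt_pos.2 (sq_interval_pos_of_mem hp)).ne'
  simp only [Xi, hu hp, qst]
  field_simp

/-- `Ξ^{I,J}` is smooth on `{|x| < t}`, homogeneous of degree `−|I|`, and all its
derivatives `∂^{I₁} L^{J₁} Ξ^{I,J}` are bounded on `{|x| ≤ t − 1}`. -/
theorem Xi_smooth_homogeneous_bounded (I : List (Fin 4)) (J : List (Fin 3)) :
    ContDiffOn ℝ (⊤ : ℕ∞) (Xi I J) {p : Spt | ‖p.2‖ < p.1} ∧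
    (∀ l : ℝ, 0 < l → ∀ p : Spt, ‖p.2‖ < p.1 →
      Xi I J (l * p.1, l • p.2) = l ^ (-(I.length : ℝ)) * Xi I J p) ∧
    ∀ (I₁ : List (Fin 4)) (J₁ : List (Fin 3)), ∃ C : ℝ,
      ∀ p : Spt, ‖p.2‖ ≤ p.1 - 1 → |pdW I₁ (lbW J₁ (Xi I J)) p| ≤ C := by
  have h := conePoly_Xi I J
  refine ⟨h.contDiffOn, fun l hl p hp => ?_, fun I₁ J₁ => (h.pdW_lbW I₁ J₁).bounded⟩
  rw [h.homogeneous hl hp, Real.rpow_neg hl.le, Real.rpow_natCast, inv_pow]
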